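/- Let L be a finite-dimensional Lie algebra over a field K of characteristic zero, let A be an abelian Lie subalgebra of L, and let n > 1 be an integer such that the n-th term of the lower central series of L is contained in [A, L]. Set S = L^{n-1}, the (n-1)-th term of the lower central series, which is an ideal of L. Then for every x ∈ S and every y in the derived subalgebra [S, S], the trace of the composite linear map (ad_S x) ∘ (ad_S y) : S → S is zero, where ad_S z denotes the adjoint action of z on S. -/

import Mathlib

/-- If `A` is abelian and `[L, S] ⊆ [A, L]` for a Lie ideal `S`, then `S` and `[L, S]` are
orthogonal with respect to the trace form of any representation of `L`: by invariance `A` is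
orthogonal to `[A, L] ⊇ [L, S]`, whence `[A, L]` is orthogonal to `S`. -/
theorem traceForm_eq_zero_of_lie_le_span
    {K L M : Type*} [CommRing K] [LieRing L] [LieAlgebra K L]
    [AddCommGroup M] [Module K M] [LieRingModule L M] [LieModule K L M]
    (A : LieSubalgebra K L) (hA : IsLieAbelian A) (S : LieIdeal K L)
    (h : (⁅(⊤ : LieIdeal K L), S⁆ : LieIdeal K L).toSubmodule ≤
      Submodule.span K {z : L | ∃ a ∈ A, ∃ x : L, z = ⁅a, x⁆})
    {x y : L} (hx : x ∈ S) (hy : y ∈ ⁅(⊤ : LieIdeal K L), S⁆) :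
    LieModule.traceForm K L M x y = 0 := by
  have h_orth : ∀ a ∈ A, ∀ z ∈ ⁅(⊤ : LieIdeal K L), S⁆,
      LieModule.traceForm K L M a z = 0 := by
    intro a ha z hz
    refine (Submodule.span_le (p := LinearMap.ker (LieModule.traceForm K L M a))).2 ?_ (h hz)
    rintro _ ⟨b, hb, m, rfl⟩
    have hab : ⁅a, b⁆ = 0 := congrArg Subtype.val (hA.trivial ⟨a, ha⟩ ⟨b, hb⟩)
    simp [← LieModule.traceForm_apply_lie_apply, hab]
  refine (Submodule.span_le (p := LinearMap.ker (LieModule.traceForm K L M x))).2 ?_ (h hy)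
  rintro _ ⟨a, ha, u, rfl⟩
  rw [SetLike.mem_coe, LinearMap.mem_ker, LieModule.traceForm_comm,
    LieModule.traceForm_apply_lie_apply]
  exact h_orth a ha _ (LieSubmodule.lie_mem_lie (LieSubmodule.mem_top u) hx)

/-- With `L`, `A`, `n` as in the main theorem and `S = L^{n-1}` (a term
of the lower central series, an ideal of `L`), for every `x ∈ S` and every
`y ∈ [S, S]`, the trace of `(ad_S x) ∘ (ad_S y) : S → S` is zero. -/
theorem trace_adS_comp_adS_eq_zero
    {K L : Type*} [Field K] [CharZero K] [LieRing L] [LieAlgebra K L]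
    [FiniteDimensional K L]
    (A : LieSubalgebra K L) (hA : IsLieAbelian A)
    (n : ℕ) (hn : 1 < n)
    (h : (LieModule.lowerCentralSeries K L L (n - 1) : Submodule K L) ≤
      Submodule.span K {z : L | ∃ a ∈ A, ∃ x : L, z = ⁅a, x⁆})
    (S : LieIdeal K L) (hS : S = LieModule.lowerCentralSeries K L L (n - 2))
    (x y : L) (hx : x ∈ S) (hy : y ∈ ⁅S, S⁆) :
    LinearMap.trace K S
      (LieModule.toEnd K L S x ∘ₗ LieModule.toEnd K L S y) = 0 := by
  obtain ⟨k, rfl⟩ : ∃ k, n = k + 2 := ⟨n - 2, by omega⟩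
  simp only [Nat.add_sub_cancel, show k + 2 - 1 = k + 1 by omega] at h hS
  have h_lie : (⁅(⊤ : LieIdeal K L), S⁆ : LieIdeal K L).toSubmodule ≤
      Submodule.span K {z : L | ∃ a ∈ A, ∃ x : L, z = ⁅a, x⁆} := by
    rwa [hS, ← LieModule.lowerCentralSeries_succ]
  exact traceForm_eq_zero_of_lie_le_span A hA S h_lie hx
    (LieSubmodule.mono_lie_left S le_top hy)
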